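/- arXiv:1810.04232 — 2 statements merged into one kernel-verified Lean document; each statement's English description precedes it below -/
import Mathlib

section
/- Assume c := f′(0) ∈ ℝ. Then there exist δ′ ∈ (0, δ²) and C > 0 such that for all real x with |x| < δ′, | S(x) + (2c/3)·max(−x, 0)^{3/2} | ≤ C·x². In particular, S(x) vanishes to order x^{3/2} on the side x < 0 with explicit leading coefficient −2c/3, and S(x) = O(x²) on the side x ≥ 0 (and if all Taylor coefficients of f at 0 are real then S(x) = 0 for 0 ≤ x < δ′). -/
/-- The principal complex square root of a real number: `√t` for `t ≥ 0` and
`i·√(−t)` for `t < 0`. -/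
noncomputable def sqrtC (t : ℝ) : ℂ :=
  if 0 ≤ t then (Real.sqrt t : ℂ) else Complex.I * (Real.sqrt (-t) : ℂ)

theorem continuous_sqrtC : Continuous sqrtC := by
  unfold sqrtC
  refine Continuous.if_le (by fun_prop) (by fun_prop) continuous_const continuous_id ?_
  rintro t rfl
  simp

theorem norm_sqrtC_sq (t : ℝ) : ‖sqrtC t‖ ^ 2 = |t| := by
  unfold sqrtC
  split_ifs with h
  · simp [abs_of_nonneg h, Real.sq_sqrt h]
  · have h' : 0 ≤ -t := by linarith
    simp [abs_of_nonpos (not_le.mp h).le, Real.sq_sqrt h']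

theorem im_sqrtC (t : ℝ) : (sqrtC t).im = √(-t) := by
  unfold sqrtC
  split_ifs with h
  · simp [Real.sqrt_eq_zero_of_nonpos (neg_nonpos.mpr h)]
  · simp

theorem integral_sqrt_neg (x : ℝ) :
    ∫ t in (0 : ℝ)..x, √(-t) = -(2 / 3) * max (-x) 0 ^ ((3 : ℝ) / 2) := by
  rcases le_total 0 x with hx | hx
  · rw [max_eq_right (by linarith), Real.zero_rpow (by norm_num), mul_zero]
    refine intervalIntegral.integral_zero_ae (Filter.Eventually.of_forall fun t ht => ?_)
    rw [Set.uIoc_of_le hx] at ht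
    exact Real.sqrt_eq_zero_of_nonpos (by linarith [ht.1])
  · rw [max_eq_left (by linarith), intervalIntegral.integral_comp_neg (fun t => √t)]
    simp only [Real.sqrt_eq_rpow]
    rw [integral_rpow (Or.inl (by norm_num)), neg_zero, Real.zero_rpow (by norm_num)]
    norm_num
    ring

theorem AnalyticAt.sub_sub_deriv_mul_isBigO {f : ℂ → ℂ} (hf : AnalyticAt ℂ f 0) :
    (fun z => f z - f 0 - deriv f 0 * z) =O[nhds 0] fun z => ‖z‖ ^ 2 := by
  obtain ⟨p, hp⟩ := hf
  have h := hp.isBigO_sub_partialSum_pow 2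
  refine h.congr_left fun z => ?_
  have h0 : p.coeff 0 = f 0 := hp.coeff_zero _
  have h1 : p.coeff 1 = deriv f 0 := hp.deriv.symm
  simp [FormalMultilinearSeries.partialSum, Finset.sum_range_succ, h0, h1]
  ring

/-- One-dimensional model of the action function near a fold caustic.  Let `f` be
holomorphic on the disc of radius `δ` with `f(0) ∈ ℝ` and `c := f′(0) ∈ ℝ`, and let
`S(x) = Im ∫₀ˣ f(√t) dt` for `|x| < δ²`.  Then there are `δ′ ∈ (0, δ²)` and `C > 0` such
that `|S(x) + (2c/3)·max(−x,0)^{3/2}| ≤ C·x²` for all `|x| < δ′`. -/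
theorem action_function_fold_asymptotics
    (δ : ℝ) (hδ : 0 < δ) (f : ℂ → ℂ)
    (hf : DifferentiableOn ℂ f (Metric.ball 0 δ))
    (hf0 : (f 0).im = 0)
    (c : ℝ) (hc : deriv f 0 = (c : ℂ))
    (S : ℝ → ℝ)
    (hS : ∀ x : ℝ, |x| < δ ^ 2 → S x = (∫ t in (0:ℝ)..x, f (sqrtC t)).im) :
    ∃ δ' : ℝ, 0 < δ' ∧ δ' < δ ^ 2 ∧ ∃ C > (0 : ℝ), ∀ x : ℝ, |x| < δ' →
      |S x + (2 * c / 3) * max (-x) 0 ^ ((3 : ℝ) / 2)| ≤ C * x ^ 2 := by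
  have han : AnalyticAt ℂ f 0 := hf.analyticAt (Metric.ball_mem_nhds 0 hδ)
  obtain ⟨K, hK, hbound⟩ := han.sub_sub_deriv_mul_isBigO.exists_pos
  obtain ⟨ε, hε, hball⟩ := Metric.eventually_nhds_iff.mp hbound.bound
  have hρ : 0 < min ε δ / 2 := by positivity
  set ρ := min ε δ / 2 with hρ_def
  have hρε : ρ < ε := by linarith [min_le_left ε δ]
  have hρδ : ρ < δ := by linarith [min_le_right ε δ]
  refine ⟨ρ ^ 2, by positivity, by gcongr, K, hK, fun x hx => ?_⟩
  have habs : ∀ t ∈ Set.uIcc 0 x, |t| ≤ |x| := fun t ht => by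
    simpa using Set.abs_sub_left_of_mem_uIcc ht
  have hsmall : ∀ t ∈ Set.uIcc 0 x, ‖sqrtC t‖ < ρ := fun t ht => by
    refine lt_of_pow_lt_pow_left₀ 2 hρ.le ?_
    rw [norm_sqrtC_sq]
    exact (habs t ht).trans_lt hx
  have hcont : ContinuousOn (fun t => f (sqrtC t)) (Set.uIcc 0 x) :=
    hf.continuousOn.comp continuous_sqrtC.continuousOn fun t ht => by
      simpa using (hsmall t ht).trans hρδ
  have him : S x = ∫ t in (0 : ℝ)..x, (f (sqrtC t)).im := by
    rw [hS x (hx.trans (by gcongr))]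
    exact (Complex.imCLM.intervalIntegral_comp_comm hcont.intervalIntegrable).symm
  have hmain : S x + (2 * c / 3) * max (-x) 0 ^ ((3 : ℝ) / 2) =
      ∫ t in (0 : ℝ)..x, ((f (sqrtC t)).im - c * √(-t)) := by
    rw [intervalIntegral.integral_sub, intervalIntegral.integral_const_mul, integral_sqrt_neg,
      him]
    · ring
    · exact (Complex.continuous_im.comp_continuousOn hcont).intervalIntegrable
    · exact Continuous.intervalIntegrable (by fun_prop) _ _
  have hle : ∀ t ∈ Set.uIoc 0 x, ‖(f (sqrtC t)).im - c * √(-t)‖ ≤ K * |x| := fun t ht => by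
    have ht' := Set.uIoc_subset_uIcc ht
    have him_eq : (f (sqrtC t)).im - c * √(-t) =
        (f (sqrtC t) - f 0 - deriv f 0 * sqrtC t).im := by
      simp [hc, hf0, im_sqrtC]
    have hb := hball (y := sqrtC t) (by simpa using (hsmall t ht').trans hρε)
    rw [norm_pow, norm_norm, norm_sqrtC_sq] at hb
    rw [him_eq, Real.norm_eq_abs]
    exact (Complex.abs_im_le_norm _).trans
      (hb.trans (mul_le_mul_of_nonneg_left (habs t ht') hK.le))
  have hint := intervalIntegral.norm_integral_le_of_norm_le_const hle
  rw [hmain, ← Real.norm_eq_abs]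
  refine hint.trans_eq ?_
  rw [sub_zero, mul_assoc, abs_mul_abs_self, sq]
end

section
/- For every h > 0 and every smooth function u : ℝ² → ℂ, the semiclassical Liouville Laplacian P₁ and its quantum integral P₂ commute: P₁(P₂ u) = P₂(P₁ u), where P₁u = −(a(x₁)+b(x₂))^{−1}·h²·(∂²u/∂x₁² + ∂²u/∂x₂²) and P₂u = −(a(x₁)+b(x₂))^{−1}·h²·(b(x₂)·∂²u/∂x₁² − a(x₁)·∂²u/∂x₂²). -/
/-- Second partial derivative in the first variable of `u : ℝ² → ℂ`. -/
noncomputable def dxx (u : ℝ × ℝ → ℂ) : ℝ × ℝ → ℂ :=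
  fun p => deriv (fun s => deriv (fun s' => u (s', p.2)) s) p.1

/-- Second partial derivative in the second variable of `u : ℝ² → ℂ`. -/
noncomputable def dyy (u : ℝ × ℝ → ℂ) : ℝ × ℝ → ℂ :=
  fun p => deriv (fun t => deriv (fun t' => u (p.1, t')) t) p.2

/-- The semiclassical Liouville Laplacian
`P₁u = −(a(x₁)+b(x₂))⁻¹·h²·(∂²u/∂x₁² + ∂²u/∂x₂²)`. -/
noncomputable def LiouvilleP1 (a b : ℝ → ℝ) (h : ℝ) (u : ℝ × ℝ → ℂ) : ℝ × ℝ → ℂ :=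
  fun p => -((a p.1 + b p.2 : ℝ) : ℂ)⁻¹ * (h : ℂ) ^ 2 * (dxx u p + dyy u p)

/-- The quantum integral of the Liouville Laplacian
`P₂u = −(a(x₁)+b(x₂))⁻¹·h²·(b(x₂)·∂²u/∂x₁² − a(x₁)·∂²u/∂x₂²)`. -/
noncomputable def LiouvilleP2 (a b : ℝ → ℝ) (h : ℝ) (u : ℝ × ℝ → ℂ) : ℝ × ℝ → ℂ :=
  fun p => -((a p.1 + b p.2 : ℝ) : ℂ)⁻¹ * (h : ℂ) ^ 2 *
    ((b p.2 : ℂ) * dxx u p - (a p.1 : ℂ) * dyy u p)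

/-- The derivative of `u` along the constant vector field `v`. -/
noncomputable def dirDeriv (v : ℝ × ℝ) (u : ℝ × ℝ → ℂ) : ℝ × ℝ → ℂ :=
  fun p => fderiv ℝ u p v

theorem contDiff_dirDeriv (v : ℝ × ℝ) {u : ℝ × ℝ → ℂ} (hu : ContDiff ℝ (⊤ : ℕ∞) u) :
    ContDiff ℝ (⊤ : ℕ∞) (dirDeriv v u) :=
  (hu.fderiv_right (m := (⊤ : ℕ∞)) (by simp)).clm_apply contDiff_const

theorem dirDeriv_comm (v w : ℝ × ℝ) {u : ℝ × ℝ → ℂ} (hu : ContDiff ℝ (⊤ : ℕ∞) u) :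
    dirDeriv v (dirDeriv w u) = dirDeriv w (dirDeriv v u) := by
  funext p
  have hd : DifferentiableAt ℝ (fderiv ℝ u) p :=
    (hu.fderiv_right (m := (⊤ : ℕ∞)) (by simp)).differentiable (by simp) p
  have key (v w : ℝ × ℝ) :
      dirDeriv v (dirDeriv w u) p = fderiv ℝ (fderiv ℝ u) p v w := by
    unfold dirDeriv
    rw [fderiv_clm_apply hd (differentiableAt_const w)]
    simp
  have hs : IsSymmSndFDerivAt ℝ u p := hu.contDiffAt.isSymmSndFDerivAt (by
    simpa using WithTop.coe_le_coe.2 (le_top : (2 : ℕ∞) ≤ ⊤))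
  rw [key, key, hs.eq]

theorem deriv_fst_eq_dirDeriv {u : ℝ × ℝ → ℂ} (hu : ContDiff ℝ (⊤ : ℕ∞) u) (s t : ℝ) :
    deriv (fun s' => u (s', t)) s = dirDeriv (1, 0) u (s, t) :=
  (HasFDerivAt.comp_hasDerivAt s (hu.differentiable (by simp) (s, t)).hasFDerivAt
    ((hasDerivAt_id s).prodMk (hasDerivAt_const s t))).deriv

theorem deriv_snd_eq_dirDeriv {u : ℝ × ℝ → ℂ} (hu : ContDiff ℝ (⊤ : ℕ∞) u) (s t : ℝ) :
    deriv (fun t' => u (s, t')) t = dirDeriv (0, 1) u (s, t) :=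
  (HasFDerivAt.comp_hasDerivAt t (hu.differentiable (by simp) (s, t)).hasFDerivAt
    ((hasDerivAt_const t s).prodMk (hasDerivAt_id t))).deriv

theorem dxx_eq_dirDeriv {u : ℝ × ℝ → ℂ} (hu : ContDiff ℝ (⊤ : ℕ∞) u) :
    dxx u = dirDeriv (1, 0) (dirDeriv (1, 0) u) := by
  funext p
  simp only [dxx, deriv_fst_eq_dirDeriv hu, deriv_fst_eq_dirDeriv (contDiff_dirDeriv _ hu)]

theorem dyy_eq_dirDeriv {u : ℝ × ℝ → ℂ} (hu : ContDiff ℝ (⊤ : ℕ∞) u) :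
    dyy u = dirDeriv (0, 1) (dirDeriv (0, 1) u) := by
  funext p
  simp only [dyy, deriv_snd_eq_dirDeriv hu, deriv_snd_eq_dirDeriv (contDiff_dirDeriv _ hu)]

theorem contDiff_dxx {u : ℝ × ℝ → ℂ} (hu : ContDiff ℝ (⊤ : ℕ∞) u) :
    ContDiff ℝ (⊤ : ℕ∞) (dxx u) := by
  rw [dxx_eq_dirDeriv hu]
  exact contDiff_dirDeriv _ (contDiff_dirDeriv _ hu)

theorem contDiff_dyy {u : ℝ × ℝ → ℂ} (hu : ContDiff ℝ (⊤ : ℕ∞) u) :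
    ContDiff ℝ (⊤ : ℕ∞) (dyy u) := by
  rw [dyy_eq_dirDeriv hu]
  exact contDiff_dirDeriv _ (contDiff_dirDeriv _ hu)

theorem dxx_dyy_comm {u : ℝ × ℝ → ℂ} (hu : ContDiff ℝ (⊤ : ℕ∞) u) :
    dxx (dyy u) = dyy (dxx u) := by
  have h1 := contDiff_dirDeriv (1, 0) hu
  have h2 := contDiff_dirDeriv (0, 1) hu
  rw [dxx_eq_dirDeriv (contDiff_dyy hu), dyy_eq_dirDeriv (contDiff_dxx hu),
    dxx_eq_dirDeriv hu, dyy_eq_dirDeriv hu,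
    dirDeriv_comm (1, 0) (0, 1) h2, dirDeriv_comm (1, 0) (0, 1) hu,
    dirDeriv_comm (1, 0) (0, 1) (contDiff_dirDeriv _ h1), dirDeriv_comm (1, 0) (0, 1) h1]

theorem deriv_deriv_const_mul_add_const_mul {f g : ℝ → ℂ} (hf : ContDiff ℝ (⊤ : ℕ∞) f)
    (hg : ContDiff ℝ (⊤ : ℕ∞) g) (c d : ℂ) (x : ℝ) :
    deriv (fun s => deriv (fun s' => c * f s' + d * g s') s) x =
      c * deriv (fun s => deriv f s) x + d * deriv (fun s => deriv g s) x := by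
  have df : Differentiable ℝ f := hf.differentiable (by simp)
  have dg : Differentiable ℝ g := hg.differentiable (by simp)
  have df' : Differentiable ℝ (deriv f) :=
    (contDiff_infty_iff_deriv.1 hf).2.differentiable (by simp)
  have dg' : Differentiable ℝ (deriv g) :=
    (contDiff_infty_iff_deriv.1 hg).2.differentiable (by simp)
  have hs (s : ℝ) : deriv (fun s' => c * f s' + d * g s') s = c * deriv f s + d * deriv g s :=
    (((df s).hasDerivAt.const_mul c).add ((dg s).hasDerivAt.const_mul d)).deriv
  simp only [hs]
  exact (((df' x).hasDerivAt.const_mul c).add ((dg' x).hasDerivAt.const_mul d)).deriv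

theorem dxx_mul_add_const_mul {v w : ℝ × ℝ → ℂ} (hv : ContDiff ℝ (⊤ : ℕ∞) v)
    (hw : ContDiff ℝ (⊤ : ℕ∞) w) (β : ℝ → ℂ) (d : ℂ) (p : ℝ × ℝ) :
    dxx (fun q => β q.2 * v q + d * w q) p = β p.2 * dxx v p + d * dxx w p :=
  deriv_deriv_const_mul_add_const_mul (hv.comp (contDiff_id.prodMk contDiff_const))
    (hw.comp (contDiff_id.prodMk contDiff_const)) (β p.2) d p.1

theorem dyy_mul_add_const_mul {v w : ℝ × ℝ → ℂ} (hv : ContDiff ℝ (⊤ : ℕ∞) v)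
    (hw : ContDiff ℝ (⊤ : ℕ∞) w) (α : ℝ → ℂ) (d : ℂ) (p : ℝ × ℝ) :
    dyy (fun q => α q.1 * v q + d * w q) p = α p.1 * dyy v p + d * dyy w p :=
  deriv_deriv_const_mul_add_const_mul (hv.comp (contDiff_const.prodMk contDiff_id))
    (hw.comp (contDiff_const.prodMk contDiff_id)) (α p.1) d p.2

theorem contDiff_liouvilleP1 {a b : ℝ → ℝ} (ha : ContDiff ℝ (⊤ : ℕ∞) a)
    (hb : ContDiff ℝ (⊤ : ℕ∞) b) (hne : ∀ s t : ℝ, a s + b t ≠ 0) (h : ℝ)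
    {u : ℝ × ℝ → ℂ} (hu : ContDiff ℝ (⊤ : ℕ∞) u) :
    ContDiff ℝ (⊤ : ℕ∞) (LiouvilleP1 a b h u) := by
  have hab : ContDiff ℝ (⊤ : ℕ∞) (fun p : ℝ × ℝ => ((a p.1 + b p.2 : ℝ) : ℂ)) :=
    Complex.ofRealCLM.contDiff.comp ((ha.comp contDiff_fst).add (hb.comp contDiff_snd))
  have hinv := hab.inv fun p => Complex.ofReal_ne_zero.2 (hne p.1 p.2)
  exact (hinv.neg.mul contDiff_const).mul ((contDiff_dxx hu).add (contDiff_dyy hu))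

/-- Quantum complete integrability of the Liouville Laplacian: for smooth `a, b` with
`a + b > 0`, any `h > 0` and any smooth `u : ℝ² → ℂ`, the operators `P₁` and `P₂`
commute: `P₁(P₂u) = P₂(P₁u)`. -/
theorem liouville_laplacian_commutes
    (a b : ℝ → ℝ) (ha : ContDiff ℝ (⊤ : ℕ∞) a) (hb : ContDiff ℝ (⊤ : ℕ∞) b)
    (hpos : ∀ s t : ℝ, 0 < a s + b t)
    (h : ℝ) (hh : 0 < h)
    (u : ℝ × ℝ → ℂ) (hu : ContDiff ℝ (⊤ : ℕ∞) u) :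
    LiouvilleP1 a b h (LiouvilleP2 a b h u) = LiouvilleP2 a b h (LiouvilleP1 a b h u) := by
  have hf := contDiff_liouvilleP1 ha hb (fun s t => (hpos s t).ne') h hu
  have hne (p : ℝ × ℝ) : (a p.1 : ℂ) + b p.2 ≠ 0 := by
    exact_mod_cast (hpos p.1 p.2).ne'
  have g_eq_dyy : LiouvilleP2 a b h u =
      fun q => (b q.2 : ℂ) * LiouvilleP1 a b h u q + (h : ℂ) ^ 2 * dyy u q := by
    funext q
    have := hne q
    simp only [LiouvilleP1, LiouvilleP2]
    push_cast
    field_simp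
    ring
  have g_eq_dxx : LiouvilleP2 a b h u =
      fun q => (-a q.1 : ℂ) * LiouvilleP1 a b h u q + -(h : ℂ) ^ 2 * dxx u q := by
    funext q
    have := hne q
    simp only [LiouvilleP1, LiouvilleP2]
    push_cast
    field_simp
    ring
  funext p
  have hx : dxx (LiouvilleP2 a b h u) p =
      b p.2 * dxx (LiouvilleP1 a b h u) p + (h : ℂ) ^ 2 * dxx (dyy u) p := by
    rw [g_eq_dyy]
    exact dxx_mul_add_const_mul hf (contDiff_dyy hu) (fun t => (b t : ℂ)) _ p
  have hy : dyy (LiouvilleP2 a b h u) p =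
      -a p.1 * dyy (LiouvilleP1 a b h u) p + -(h : ℂ) ^ 2 * dyy (dxx u) p := by
    rw [g_eq_dxx]
    exact dyy_mul_add_const_mul hf (contDiff_dxx hu) (fun s => (-a s : ℂ)) _ p
  rw [LiouvilleP1, LiouvilleP2, hx, hy, dxx_dyy_comm hu]
  ring
end
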